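/- Let n ≥ 2 and let G ⊆ U(n) be a finite subgroup. Set dim H(λ) = Σ over pairs (p,q) with 0 < q(p+n−1) ≤ λ of dim_ℂ H_{p,q}, and dim H^G(λ) = Σ over the same pairs of dim_ℂ H_{p,q}^G. Then lim_{λ→∞} dim H(λ)/dim H^G(λ) = |G|. -/

import Mathlib

noncomputable section

open MvPolynomial Matrix Complex Real Filter

/-- Variables: `Sum.inl i` is `z i`, `Sum.inr i` is `conj (z i)`. -/
abbrev Var (n : ℕ) := Fin n ⊕ Fin n

/-- Bidegree weight: `z`-variables have weight (1,0), `z̄`-variables weight (0,1). -/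
def bidegWt (n : ℕ) : Var n → ℕ × ℕ :=
  Sum.elim (fun _ => ((1 : ℕ), (0 : ℕ))) (fun _ => ((0 : ℕ), (1 : ℕ)))

/-- The Laplacian `∑ i, ∂²/∂zᵢ∂z̄ᵢ` on polynomials in `z, z̄`. -/
def kohnLap (n : ℕ) : MvPolynomial (Var n) ℂ →ₗ[ℂ] MvPolynomial (Var n) ℂ :=
  ∑ i : Fin n, ((pderiv (R := ℂ) (Sum.inl i)).toLinearMap.comp
    (pderiv (R := ℂ) (Sum.inr i)).toLinearMap)

/-- `H_{p,q}`: harmonic polynomials on ℂⁿ of bidegree `(p,q)`. -/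
def Hpq (n p q : ℕ) : Submodule ℂ (MvPolynomial (Var n) ℂ) :=
  (weightedHomogeneousSubmodule ℂ (bidegWt n) (p, q)) ⊓ (LinearMap.ker (kohnLap n))

/-- The action of a unitary matrix `g` on polynomials, `(g · f)(z) = f(g⁻¹ z)`:
substitution `zᵢ ↦ ∑ⱼ (g⁻¹)ᵢⱼ zⱼ`, `z̄ᵢ ↦ ∑ⱼ conj((g⁻¹)ᵢⱼ) z̄ⱼ`. -/
def uAct (n : ℕ) (g : Matrix.unitaryGroup (Fin n) ℂ) :
    MvPolynomial (Var n) ℂ →ₐ[ℂ] MvPolynomial (Var n) ℂ :=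
  aeval (Sum.elim
    (fun i => ∑ j : Fin n,
      MvPolynomial.C ((g⁻¹ : Matrix.unitaryGroup (Fin n) ℂ) i j) * X (Sum.inl j))
    (fun i => ∑ j : Fin n,
      MvPolynomial.C ((starRingEnd ℂ) ((g⁻¹ : Matrix.unitaryGroup (Fin n) ℂ) i j)) * X (Sum.inr j)))

/-- `H_{p,q}^S`: the subspace of `H_{p,q}` invariant under every element of `S`. -/
def HpqInv (n p q : ℕ) (S : Set (Matrix.unitaryGroup (Fin n) ℂ)) :
    Submodule ℂ (MvPolynomial (Var n) ℂ) :=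
  Hpq n p q ⊓ (⨅ g ∈ S, LinearMap.ker ((uAct n g).toLinearMap - LinearMap.id))

/-- `dim_ℂ H_{p,q}^S`. -/
def dimHpqInv (n p q : ℕ) (S : Set (Matrix.unitaryGroup (Fin n) ℂ)) : ℕ :=
  Module.finrank ℂ (HpqInv n p q S)

/-- A set of unitary matrices acts freely on the sphere iff no element other than
the identity has `1` as an eigenvalue. -/
def actsFreely {n : ℕ} (S : Set (Matrix.unitaryGroup (Fin n) ℂ)) : Prop :=
  ∀ g ∈ S, ((g : Matrix (Fin n) (Fin n) ℂ) - 1).det = 0 → g = 1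

/-- `dim H(λ) = ∑_{0 < q(p+n-1) ≤ λ} dim H_{p,q}`. -/
def dimHlam (n : ℕ) (lam : ℝ) : ℕ :=
  ∑ pq ∈ (Finset.range (⌊lam⌋₊ + 1) ×ˢ Finset.range (⌊lam⌋₊ + 1)).filter
      (fun pq => 0 < pq.2 * (pq.1 + n - 1) ∧ ((pq.2 * (pq.1 + n - 1) : ℕ) : ℝ) ≤ lam),
    Module.finrank ℂ (Hpq n pq.1 pq.2)

/-- `dim H^G(λ) = ∑_{0 < q(p+n-1) ≤ λ} dim H_{p,q}^G`. -/
def dimHGlam (n : ℕ) (S : Set (Matrix.unitaryGroup (Fin n) ℂ)) (lam : ℝ) : ℕ :=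
  ∑ pq ∈ (Finset.range (⌊lam⌋₊ + 1) ×ˢ Finset.range (⌊lam⌋₊ + 1)).filter
      (fun pq => 0 < pq.2 * (pq.1 + n - 1) ∧ ((pq.2 * (pq.1 + n - 1) : ℕ) : ℝ) ≤ lam),
    dimHpqInv n pq.1 pq.2 S

/-- Polynomials of bidegree `x`. -/
def bideg (n : ℕ) (x : ℕ × ℕ) : Submodule ℂ (MvPolynomial (Var n) ℂ) :=
  weightedHomogeneousSubmodule ℂ (bidegWt n) x

/-- Polynomials invariant under every element of `S`. -/
def invariantPoly (n : ℕ) (S : Set (Matrix.unitaryGroup (Fin n) ℂ)) :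
    Submodule ℂ (MvPolynomial (Var n) ℂ) :=
  ⨅ g ∈ S, LinearMap.ker ((uAct n g).toLinearMap - LinearMap.id)

/-- Invariant polynomials of bidegree `x`. -/
def bidegInv (n : ℕ) (S : Set (Matrix.unitaryGroup (Fin n) ℂ)) (x : ℕ × ℕ) :
    Submodule ℂ (MvPolynomial (Var n) ℂ) :=
  bideg n x ⊓ invariantPoly n S

lemma mem_invariantPoly {n : ℕ} {S : Set (Matrix.unitaryGroup (Fin n) ℂ)}
    {f : MvPolynomial (Var n) ℂ} : f ∈ invariantPoly n S ↔ ∀ g ∈ S, uAct n g f = f := by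
  simp [invariantPoly, Submodule.mem_iInf, sub_eq_zero]

lemma weight_bidegWt {n : ℕ} (d : Var n →₀ ℕ) :
    Finsupp.weight (bidegWt n) d = (∑ i, d (Sum.inl i), ∑ i, d (Sum.inr i)) := by
  rw [Finsupp.weight_apply, Finsupp.sum_fintype _ _ (by simp), Fintype.sum_sum_type]
  ext <;> simp [bidegWt, Prod.fst_sum, Prod.snd_sum]

/-- Monomials of bidegree `(p, q)` are pairs of monomials of degrees `p` and `q`. -/
def bidegMonomialEquiv (n p q : ℕ) :
    {d : Var n →₀ ℕ | Finsupp.weight (bidegWt n) d = (p, q)} ≃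
      (Finset.univ : Finset (Fin n)).finsuppAntidiag p ×
        (Finset.univ : Finset (Fin n)).finsuppAntidiag q :=
  (Finsupp.sumFinsuppEquivProdFinsupp.subtypeEquiv (q := fun x =>
    x.1 ∈ (Finset.univ : Finset (Fin n)).finsuppAntidiag p ∧
      x.2 ∈ (Finset.univ : Finset (Fin n)).finsuppAntidiag q) (fun d => by
      simp only [Set.mem_ofPred_eq, weight_bidegWt, Prod.mk.injEq, Finset.mem_finsuppAntidiag,
        Finset.subset_univ, and_true]
      rfl)).trans
  (Equiv.subtypeProdEquivProd)

instance finite_bidegMonomial (n : ℕ) (x : ℕ × ℕ) :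
    Finite {d : Var n →₀ ℕ | Finsupp.weight (bidegWt n) d = x} :=
  Finite.of_equiv _ (bidegMonomialEquiv n x.1 x.2).symm

/-- The monomial basis of the polynomials of bidegree `x`. -/
def bidegBasis (n : ℕ) (x : ℕ × ℕ) :
    Module.Basis {d : Var n →₀ ℕ | Finsupp.weight (bidegWt n) d = x} ℂ (bideg n x) :=
  (basisRestrictSupport ℂ _).map (LinearEquiv.ofEq _ _
    (weightedHomogeneousSubmodule_eq_finsupp_supported ℂ (bidegWt n) x).symm)

instance finiteDimensional_bideg (n : ℕ) (x : ℕ × ℕ) : FiniteDimensional ℂ (bideg n x) :=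
  (bidegBasis n x).finiteDimensional_of_finite

instance finiteDimensional_bidegInv (n : ℕ) (S : Set (Matrix.unitaryGroup (Fin n) ℂ))
    (x : ℕ × ℕ) : FiniteDimensional ℂ (bidegInv n S x) :=
  Submodule.finiteDimensional_of_le inf_le_left

lemma finrank_bideg (n p q : ℕ) :
    Module.finrank ℂ (bideg n (p, q)) = n.multichoose p * n.multichoose q := by
  rw [Module.finrank_eq_nat_card_basis (bidegBasis n (p, q)),
    Nat.card_congr (bidegMonomialEquiv n p q), Nat.card_prod]
  rw [Nat.card_eq_fintype_card, Nat.card_eq_fintype_card, Fintype.card_coe, Fintype.card_coe,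
    Finset.card_finsuppAntidiag_nat_eq_multichoose,
    Finset.card_finsuppAntidiag_nat_eq_multichoose, Finset.card_univ, Fintype.card_fin]

lemma iSupIndep_bideg (n : ℕ) : iSupIndep (bideg n) :=
  letI := weightedDecomposition ℂ (bidegWt n)
  (DirectSum.Decomposition.isInternal
    (weightedHomogeneousSubmodule ℂ (bidegWt n))).submodule_iSupIndep

lemma uAct_X_inl {n : ℕ} (g : Matrix.unitaryGroup (Fin n) ℂ) (i : Fin n) :
    uAct n g (X (Sum.inl i)) =
      ∑ j, C ((g⁻¹ : Matrix.unitaryGroup (Fin n) ℂ) i j) * X (Sum.inl j) := by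
  simp [uAct]

lemma uAct_X_inr {n : ℕ} (g : Matrix.unitaryGroup (Fin n) ℂ) (i : Fin n) :
    uAct n g (X (Sum.inr i)) =
      ∑ j, C ((starRingEnd ℂ) ((g⁻¹ : Matrix.unitaryGroup (Fin n) ℂ) i j)) * X (Sum.inr j) := by
  simp [uAct]

lemma uAct_one {n : ℕ} : uAct n 1 = AlgHom.id ℂ _ := by
  ext1 v
  rcases v with i | i
  · rw [uAct_X_inl]
    simp [Matrix.one_apply]
  · rw [uAct_X_inr]
    simp [Matrix.one_apply]

lemma mul_inv_apply {n : ℕ} (g h : Matrix.unitaryGroup (Fin n) ℂ) (i j : Fin n) :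
    ((g * h)⁻¹ : Matrix.unitaryGroup (Fin n) ℂ) i j =
      ∑ k, (h⁻¹ : Matrix.unitaryGroup (Fin n) ℂ) i k *
        (g⁻¹ : Matrix.unitaryGroup (Fin n) ℂ) k j := by
  rw [_root_.mul_inv_rev, Matrix.UnitaryGroup.mul_apply, Matrix.mul_apply]

lemma uAct_mul {n : ℕ} (g h : Matrix.unitaryGroup (Fin n) ℂ) :
    uAct n (g * h) = (uAct n g).comp (uAct n h) := by
  ext1 v
  rcases v with i | i
  · rw [AlgHom.comp_apply, uAct_X_inl, uAct_X_inl, map_sum]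
    simp only [mul_inv_apply, map_mul, uAct_X_inl, map_sum, algHom_C,
      MvPolynomial.algebraMap_eq, Finset.mul_sum, Finset.sum_mul]
    rw [Finset.sum_comm]
    simp only [mul_assoc]
  · rw [AlgHom.comp_apply, uAct_X_inr, uAct_X_inr, map_sum]
    simp only [mul_inv_apply, map_mul, uAct_X_inr, map_sum, algHom_C,
      MvPolynomial.algebraMap_eq, Finset.mul_sum, Finset.sum_mul]
    rw [Finset.sum_comm]
    simp only [mul_assoc]

lemma uAct_mul_apply {n : ℕ} (g h : Matrix.unitaryGroup (Fin n) ℂ) (f : MvPolynomial (Var n) ℂ) :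
    uAct n (g * h) f = uAct n g (uAct n h f) := by
  rw [uAct_mul, AlgHom.comp_apply]

lemma mul_mem_bideg {n : ℕ} {x y : ℕ × ℕ} {f g : MvPolynomial (Var n) ℂ} (hf : f ∈ bideg n x)
    (hg : g ∈ bideg n y) : f * g ∈ bideg n (x + y) :=
  IsWeightedHomogeneous.mul hf hg

lemma pow_mem_bideg {n : ℕ} {x : ℕ × ℕ} {f : MvPolynomial (Var n) ℂ} (hf : f ∈ bideg n x)
    (k : ℕ) : f ^ k ∈ bideg n (k • x) :=
  IsWeightedHomogeneous.pow hf k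

lemma X_mem_bideg {n : ℕ} (v : Var n) : X v ∈ bideg n (bidegWt n v) :=
  isWeightedHomogeneous_X _ _ _

lemma C_mul_mem_bideg {n : ℕ} {x : ℕ × ℕ} {f : MvPolynomial (Var n) ℂ} (c : ℂ)
    (hf : f ∈ bideg n x) : C c * f ∈ bideg n x :=
  IsWeightedHomogeneous.C_mul hf c

lemma uAct_X_mem_bideg {n : ℕ} (g : Matrix.unitaryGroup (Fin n) ℂ) (v : Var n) :
    uAct n g (X v) ∈ bideg n (bidegWt n v) := by
  rcases v with i | i
  · rw [uAct_X_inl]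
    exact Submodule.sum_mem _ fun j _ => C_mul_mem_bideg _ (X_mem_bideg (Sum.inl j))
  · rw [uAct_X_inr]
    exact Submodule.sum_mem _ fun j _ => C_mul_mem_bideg _ (X_mem_bideg (Sum.inr j))

lemma uAct_mem_bideg {n : ℕ} {x : ℕ × ℕ} (g : Matrix.unitaryGroup (Fin n) ℂ)
    {f : MvPolynomial (Var n) ℂ} (hf : f ∈ bideg n x) : uAct n g f ∈ bideg n x := by
  refine IsWeightedHomogeneous.induction_on (motive := fun p _ => uAct n g p ∈ bideg n x)
    (by simp) (fun p q _ _ hp hq => by rw [map_add]; exact add_mem hp hq) (fun d r hd => ?_) hf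
  rw [monomial_eq, map_mul, algHom_C, MvPolynomial.algebraMap_eq, Finsupp.prod, map_prod]
  refine C_mul_mem_bideg _ ?_
  rw [← hd, Finsupp.weight_apply, Finsupp.sum]
  refine IsWeightedHomogeneous.prod _ _ _ fun v _ => ?_
  rw [map_pow]
  exact pow_mem_bideg (uAct_X_mem_bideg g v) _

lemma kohnLap_apply {n : ℕ} (f : MvPolynomial (Var n) ℂ) :
    kohnLap n f = ∑ i, pderiv (Sum.inl i) (pderiv (Sum.inr i) f) := by
  simp [kohnLap, LinearMap.sum_apply]

lemma pderiv_uAct_inl {n : ℕ} (g : Matrix.unitaryGroup (Fin n) ℂ) (i : Fin n)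
    (f : MvPolynomial (Var n) ℂ) :
    pderiv (Sum.inl i) (uAct n g f) =
      ∑ j, C ((g⁻¹ : Matrix.unitaryGroup (Fin n) ℂ) j i) * uAct n g (pderiv (Sum.inl j) f) := by
  induction f using MvPolynomial.induction_on with
  | C a => simp [MvPolynomial.algebraMap_eq]
  | add p q hp hq => simp only [map_add, hp, hq, mul_add, Finset.sum_add_distrib]
  | mul_X p v hp =>
    rw [map_mul, pderiv_mul, hp]
    simp only [pderiv_mul, map_add, map_mul, mul_add, Finset.sum_add_distrib, Finset.sum_mul,
      mul_assoc]
    congr 1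
    rcases v with k | k
    · simp only [uAct_X_inl, map_sum, pderiv_C_mul, pderiv_X, Pi.single_apply, Sum.inl.injEq]
      simp [Finset.sum_ite_eq, apply_ite, mul_comm]
    · simp only [uAct_X_inr, map_sum, pderiv_C_mul, pderiv_X, Pi.single_apply]
      simp

lemma pderiv_uAct_inr {n : ℕ} (g : Matrix.unitaryGroup (Fin n) ℂ) (i : Fin n)
    (f : MvPolynomial (Var n) ℂ) :
    pderiv (Sum.inr i) (uAct n g f) =
      ∑ j, C ((starRingEnd ℂ) ((g⁻¹ : Matrix.unitaryGroup (Fin n) ℂ) j i)) *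
        uAct n g (pderiv (Sum.inr j) f) := by
  induction f using MvPolynomial.induction_on with
  | C a => simp [MvPolynomial.algebraMap_eq]
  | add p q hp hq => simp only [map_add, hp, hq, mul_add, Finset.sum_add_distrib]
  | mul_X p v hp =>
    rw [map_mul, pderiv_mul, hp]
    simp only [pderiv_mul, map_add, map_mul, mul_add, Finset.sum_add_distrib, Finset.sum_mul,
      mul_assoc]
    congr 1
    rcases v with k | k
    · simp only [uAct_X_inl, map_sum, pderiv_C_mul, pderiv_X, Pi.single_apply]
      simp
    · simp only [uAct_X_inr, map_sum, pderiv_C_mul, pderiv_X, Pi.single_apply, Sum.inr.injEq]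
      simp [Finset.sum_ite_eq, apply_ite, mul_comm]

lemma sum_mul_conj_eq {n : ℕ} (g : Matrix.unitaryGroup (Fin n) ℂ) (j k : Fin n) :
    ∑ i, (starRingEnd ℂ) (g k i) * g j i = if j = k then 1 else 0 := by
  have h := congrFun (congrFun (Matrix.mem_unitaryGroup_iff.mp g.2) j) k
  rw [Matrix.mul_apply, Matrix.one_apply] at h
  rw [← h]
  exact Finset.sum_congr rfl fun i _ => mul_comm _ _

lemma kohnLap_uAct {n : ℕ} (g : Matrix.unitaryGroup (Fin n) ℂ) (f : MvPolynomial (Var n) ℂ) :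
    kohnLap n (uAct n g f) = uAct n g (kohnLap n f) := by
  simp only [kohnLap_apply, pderiv_uAct_inr, pderiv_uAct_inl, map_sum, pderiv_C_mul,
    Finset.mul_sum]
  rw [Finset.sum_comm]
  refine Finset.sum_congr rfl fun k _ => ?_
  rw [Finset.sum_comm]
  simp only [← mul_assoc, ← C_mul, ← Finset.sum_mul, ← map_sum, sum_mul_conj_eq]
  simp [ite_mul, apply_ite]

lemma kohnLap_mem_bideg {n p q : ℕ} {f : MvPolynomial (Var n) ℂ}
    (hf : f ∈ bideg n (p + 1, q + 1)) : kohnLap n f ∈ bideg n (p, q) := by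
  rw [kohnLap_apply]
  exact Submodule.sum_mem _ fun i _ =>
    IsWeightedHomogeneous.pderiv (n := (p + 1, q)) (IsWeightedHomogeneous.pderiv hf rfl) rfl

lemma kohnLap_monomial {n : ℕ} (d : Var n →₀ ℕ) (r : ℂ) :
    kohnLap n (monomial d r) = ∑ i, monomial
      (d - Finsupp.single (Sum.inr i) 1 - Finsupp.single (Sum.inl i) 1)
      (r * d (Sum.inr i) * d (Sum.inl i)) := by
  simp [kohnLap_apply, pderiv_monomial]

lemma kohnLap_eq_zero_of_mem_bideg {n : ℕ} {x : ℕ × ℕ} (hx : x.1 = 0 ∨ x.2 = 0)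
    {f : MvPolynomial (Var n) ℂ} (hf : f ∈ bideg n x) : kohnLap n f = 0 := by
  refine IsWeightedHomogeneous.induction_on (motive := fun p _ => kohnLap n p = 0)
    (map_zero _) (fun p q _ _ hp hq => by rw [map_add, hp, hq, add_zero]) (fun d r hd => ?_) hf
  rw [kohnLap_monomial]
  refine Finset.sum_eq_zero fun i _ => ?_
  rw [weight_bidegWt] at hd
  subst hd
  simp only [Finset.sum_eq_zero_iff, Finset.mem_univ, true_imp_iff] at hx
  rcases hx with h | h <;> simp [h i]

lemma monomial_mem_map_kohnLap {n p q : ℕ} (i₀ : Fin n) (k : ℕ) :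
    ∀ (d : Var n →₀ ℕ) (r : ℂ), Finsupp.weight (bidegWt n) d = (p, q) →
      p < d (Sum.inl i₀) + k →
      monomial d r ∈ (bideg n (p + 1, q + 1)).map (kohnLap n) := by
  induction k with
  | zero =>
    intro d r hd hp
    rw [weight_bidegWt, Prod.mk.injEq] at hd
    have := Finset.single_le_sum (f := fun i => d (Sum.inl i)) (fun i _ => Nat.zero_le _)
      (Finset.mem_univ i₀)
    omega
  | succ k ih =>
    intro d r hd hp
    set t : Var n →₀ ℕ := d + Finsupp.single (Sum.inl i₀) 1 + Finsupp.single (Sum.inr i₀) 1 with ht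
    set s : ℂ := r / (((d (Sum.inr i₀) : ℂ) + 1) * ((d (Sum.inl i₀) : ℂ) + 1)) with hs
    have hwt : Finsupp.weight (bidegWt n) t = (p + 1, q + 1) := by
      rw [ht, map_add, map_add, hd]
      simp [Finsupp.weight_single, bidegWt]
    have hmem : kohnLap n (monomial t s) ∈ (bideg n (p + 1, q + 1)).map (kohnLap n) :=
      Submodule.mem_map_of_mem (isWeightedHomogeneous_monomial _ _ _ hwt)
    rw [kohnLap_monomial, ← Finset.add_sum_erase _ _ (Finset.mem_univ i₀)] at hmem
    have hmain : monomial (t - Finsupp.single (Sum.inr i₀) 1 - Finsupp.single (Sum.inl i₀) 1)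
        (s * t (Sum.inr i₀) * t (Sum.inl i₀)) = monomial d r := by
      congr 1
      · simp [ht]
      · have h1 : ((d (Sum.inr i₀) : ℂ) + 1) ≠ 0 := Nat.cast_add_one_ne_zero _
        have h2 : ((d (Sum.inl i₀) : ℂ) + 1) ≠ 0 := Nat.cast_add_one_ne_zero _
        simp only [hs, ht, Finsupp.add_apply, Finsupp.single_apply]
        simp only [reduceCtorEq, if_true, if_false, add_zero, Nat.cast_add, Nat.cast_one]
        field_simp
    rw [hmain] at hmem
    refine (Submodule.add_mem_iff_left _ (Submodule.sum_mem _ fun i hi => ?_)).mp hmem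
    have hne : i ≠ i₀ := Finset.ne_of_mem_erase hi
    by_cases hr : t (Sum.inr i) = 0
    · simp [hr]
    by_cases hl : t (Sum.inl i) = 0
    · simp [hl]
    refine ih _ _ ?_ ?_
    · have h1 : Finsupp.single (Sum.inr i) 1 + Finsupp.single (Sum.inl i) 1 ≤ t := by
        intro v
        rcases v with j | j
        · by_cases hj : i = j
          · subst hj; simp; omega
          · simp [hj]
        · by_cases hj : i = j
          · subst hj; simp; omega
          · simp [hj]
      have h2 := congrArg (Finsupp.weight (bidegWt n)) (tsub_add_cancel_of_le h1)
      rw [hwt, map_add, ← tsub_tsub] at h2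
      simp only [map_add, Finsupp.weight_single, bidegWt, Sum.elim_inl, Sum.elim_inr, one_smul,
        Prod.mk_add_mk] at h2
      exact add_right_cancel (b := ((1 : ℕ), (1 : ℕ))) h2
    · simp [ht, hne]
      omega

lemma exists_kohnLap_eq {n p q : ℕ} (hn : 0 < n) {f : MvPolynomial (Var n) ℂ}
    (hf : f ∈ bideg n (p, q)) : ∃ F ∈ bideg n (p + 1, q + 1), kohnLap n F = f := by
  rw [← Submodule.mem_map]
  refine IsWeightedHomogeneous.induction_on
    (motive := fun f _ => f ∈ (bideg n (p + 1, q + 1)).map (kohnLap n))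
    (zero_mem _) (fun _ _ _ _ hp hq => add_mem hp hq) (fun d r hd => ?_) hf
  exact monomial_mem_map_kohnLap ⟨0, hn⟩ (p + 1) d r hd (by omega)

lemma sum_uAct_mem_bidegInv {n : ℕ} (G : Subgroup (Matrix.unitaryGroup (Fin n) ℂ)) [Fintype G]
    {x : ℕ × ℕ} {f : MvPolynomial (Var n) ℂ} (hf : f ∈ bideg n x) :
    ∑ g : G, uAct n g f ∈ bidegInv n (G : Set _) x := by
  refine ⟨Submodule.sum_mem _ fun g _ => uAct_mem_bideg _ hf, ?_⟩
  rw [SetLike.mem_coe, mem_invariantPoly]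
  intro h hh
  rw [map_sum]
  refine Fintype.sum_equiv (Equiv.mulLeft (⟨h, hh⟩ : G)) _ _ fun g => ?_
  rw [← uAct_mul_apply]
  rfl

lemma map_kohnLap_bidegInv {n : ℕ} (hn : 0 < n) (G : Subgroup (Matrix.unitaryGroup (Fin n) ℂ))
    [Finite G] (p q : ℕ) :
    (bidegInv n (G : Set _) (p + 1, q + 1)).map (kohnLap n) = bidegInv n (G : Set _) (p, q) := by
  have := Fintype.ofFinite G
  refine le_antisymm ?_ fun f hf => ?_
  · rintro _ ⟨f, hf, rfl⟩
    refine ⟨kohnLap_mem_bideg hf.1, mem_invariantPoly.mpr fun g hg => ?_⟩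
    rw [← kohnLap_uAct, mem_invariantPoly.mp hf.2 g hg]
  · obtain ⟨F, hF, rfl⟩ := exists_kohnLap_eq hn hf.1
    have hc : (Fintype.card G : ℂ) ≠ 0 := Nat.cast_ne_zero.mpr Fintype.card_ne_zero
    refine ⟨(Fintype.card G : ℂ)⁻¹ • ∑ g : G, uAct n g F,
      Submodule.smul_mem _ _ (sum_uAct_mem_bidegInv G hF), ?_⟩
    rw [map_smul, map_sum]
    simp only [kohnLap_uAct]
    rw [Finset.sum_congr rfl fun (g : G) _ => mem_invariantPoly.mp hf.2 g g.2, Finset.sum_const,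
      Finset.card_univ, ← Nat.cast_smul_eq_nsmul ℂ, smul_smul, inv_mul_cancel₀ hc, one_smul]

lemma HpqInv_eq {n p q : ℕ} (S : Set (Matrix.unitaryGroup (Fin n) ℂ)) :
    HpqInv n p q S = bidegInv n S (p, q) ⊓ LinearMap.ker (kohnLap n) := by
  rw [HpqInv, Hpq, bidegInv, inf_right_comm]
  rfl

lemma dimHpqInv_add {n : ℕ} (hn : 0 < n) (G : Subgroup (Matrix.unitaryGroup (Fin n) ℂ))
    [Finite G] (p q : ℕ) :
    Module.finrank ℂ (bidegInv n (G : Set _) (p, q)) + dimHpqInv n (p + 1) (q + 1) (G : Set _) =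
      Module.finrank ℂ (bidegInv n (G : Set _) (p + 1, q + 1)) := by
  have h := LinearMap.finrank_range_add_finrank_ker
    ((kohnLap n).domRestrict (bidegInv n (G : Set _) (p + 1, q + 1)))
  rw [LinearMap.range_domRestrict, map_kohnLap_bidegInv hn] at h
  rw [← h, dimHpqInv, HpqInv_eq, ← Submodule.map_comap_subtype,
    Submodule.finrank_map_subtype_eq]
  rfl

lemma dimHpqInv_of_eq_zero {n p q : ℕ} (h : p = 0 ∨ q = 0)
    (S : Set (Matrix.unitaryGroup (Fin n) ℂ)) :
    dimHpqInv n p q S = Module.finrank ℂ (bidegInv n S (p, q)) := by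
  rw [dimHpqInv, HpqInv_eq, inf_eq_left.mpr]
  exact fun f hf => kohnLap_eq_zero_of_mem_bideg (x := (p, q)) h hf.1

lemma bidegInv_bot {n : ℕ} (x : ℕ × ℕ) :
    bidegInv n ((⊥ : Subgroup (Matrix.unitaryGroup (Fin n) ℂ)) : Set _) x = bideg n x := by
  refine inf_eq_left.mpr fun f _ => mem_invariantPoly.mpr fun g hg => ?_
  rw [Subgroup.mem_bot.mp (SetLike.mem_coe.mp hg), uAct_one, AlgHom.id_apply]

lemma dimHpqInv_bot {n p q : ℕ} :
    dimHpqInv n p q ((⊥ : Subgroup (Matrix.unitaryGroup (Fin n) ℂ)) : Set _) =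
      Module.finrank ℂ (Hpq n p q) := by
  rw [dimHpqInv, HpqInv_eq, bidegInv_bot]
  rfl

instance finiteDimensional_Hpq (n p q : ℕ) : FiniteDimensional ℂ (Hpq n p q) :=
  Submodule.finiteDimensional_of_le (S₂ := bideg n (p, q)) inf_le_left

lemma dimHpqInv_le {n p q : ℕ} (S : Set (Matrix.unitaryGroup (Fin n) ℂ)) :
    dimHpqInv n p q S ≤ Module.finrank ℂ (Hpq n p q) :=
  Submodule.finrank_mono inf_le_left

lemma finiteDimensional_biSup {K V ι : Type*} [Field K] [AddCommGroup V] [Module K V]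
    (A : ι → Submodule K V) [∀ i, FiniteDimensional K (A i)] (s : Finset ι) :
    FiniteDimensional K (⨆ i ∈ s, A i : Submodule K V) := by
  rw [← Finset.sup_eq_iSup]
  exact Submodule.finiteDimensional_finset_sup s A

lemma finrank_biSup_eq_sum {K V ι : Type*} [Field K] [AddCommGroup V] [Module K V]
    {A : ι → Submodule K V} [∀ i, FiniteDimensional K (A i)] (hA : iSupIndep A) (s : Finset ι) :
    Module.finrank K (⨆ i ∈ s, A i : Submodule K V) = ∑ i ∈ s, Module.finrank K (A i) := by
  classical
  induction s using Finset.induction_on with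
  | empty =>
    rw [show (⨆ i ∈ (∅ : Finset ι), A i) = ⊥ by simp, finrank_bot, Finset.sum_empty]
  | insert a s ha ih =>
    have := finiteDimensional_biSup A s
    have hd : Disjoint (A a) (⨆ i ∈ s, A i) := by
      simpa using hA.disjoint_biSup (y := (s : Set ι)) (by simpa using ha)
    rw [Finset.iSup_insert, Finset.sum_insert ha, ← ih,
      ← Submodule.finrank_sup_add_finrank_inf_eq, hd.eq_bot, finrank_bot, add_zero]

lemma exists_injective_uAct {n : ℕ} (G : Subgroup (Matrix.unitaryGroup (Fin n) ℂ)) [Finite G]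
    {δ : ℕ × ℕ} (hδ : ∀ g : Matrix.unitaryGroup (Fin n) ℂ,
      (∀ f ∈ bideg n δ, uAct n g f = f) → g = 1) :
    ∃ l ∈ bideg n δ, Function.Injective fun g : G => uAct n g l := by
  let P : {g : G // g ≠ 1} → Submodule ℂ (bideg n δ) := fun g =>
    LinearMap.ker (((uAct n g.1).toLinearMap - LinearMap.id) ∘ₗ (bideg n δ).subtype)
  have hP : ∀ g f, f ∈ P g ↔ uAct n g.1 f.1 = f := fun g f => by
    simp [P, sub_eq_zero]
  have hne : ⋃ g, (P g : Set (bideg n δ)) ≠ Set.univ := fun h => by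
    obtain ⟨g, hg⟩ := Subspace.exists_eq_top_of_iUnion_eq_univ h
    refine g.2 (Subtype.ext (hδ _ fun f hf => ?_))
    exact (hP g ⟨f, hf⟩).mp (hg ▸ Submodule.mem_top)
  obtain ⟨l, hl⟩ := (Set.ne_univ_iff_exists_notMem _).mp hne
  refine ⟨l, l.2, fun g h hgh => ?_⟩
  by_contra hne'
  refine hl (Set.mem_iUnion.mpr ⟨⟨h⁻¹ * g, fun h1 => hne' (inv_mul_eq_one.mp h1).symm⟩, ?_⟩)
  rw [SetLike.mem_coe, hP]
  simp only [Subgroup.coe_mul, uAct_mul_apply] at hgh ⊢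
  rw [hgh, ← uAct_mul_apply]
  simp [uAct_one]

lemma eq_one_of_uAct_bideg_one_zero {n : ℕ} (g : Matrix.unitaryGroup (Fin n) ℂ)
    (hg : ∀ f ∈ bideg n (1, 0), uAct n g f = f) : g = 1 := by
  rw [← inv_eq_one]
  refine Subtype.ext (Matrix.ext fun i j => ?_)
  have h := congrArg (coeff (Finsupp.single (Sum.inl j) 1)) (hg _ (X_mem_bideg (Sum.inl i)))
  simp only [uAct_X_inl, coeff_sum, coeff_C_mul, coeff_X] at h
  simpa [Finsupp.single_left_inj, Matrix.one_apply] using h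

lemma eq_one_of_uAct_bideg_zero_one {n : ℕ} (g : Matrix.unitaryGroup (Fin n) ℂ)
    (hg : ∀ f ∈ bideg n (0, 1), uAct n g f = f) : g = 1 := by
  rw [← inv_eq_one]
  refine Subtype.ext (Matrix.ext fun i j => ?_)
  have h := congrArg (coeff (Finsupp.single (Sum.inr j) 1)) (hg _ (X_mem_bideg (Sum.inr i)))
  simp only [uAct_X_inr, coeff_sum, coeff_C_mul, coeff_X] at h
  have h' := congrArg (starRingEnd ℂ) h
  simpa [Finsupp.single_left_inj, Matrix.one_apply, apply_ite] using h'

lemma card_mul_sum_finrank_le {n : ℕ} (G : Subgroup (Matrix.unitaryGroup (Fin n) ℂ)) [Finite G]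
    {l : MvPolynomial (Var n) ℂ} {δ : ℕ × ℕ} (hl : l ∈ bideg n δ)
    (hinj : Function.Injective fun g : G => uAct n g l) {s t : Finset (ℕ × ℕ)}
    (hst : ∀ x ∈ s, ∀ i < Nat.card G, x + i • δ ∈ t) :
    Nat.card G * ∑ x ∈ s, Module.finrank ℂ (bidegInv n (G : Set _) x) ≤
      ∑ x ∈ t, Module.finrank ℂ (bideg n x) := by
  have hA : iSupIndep (bidegInv n (G : Set _)) := (iSupIndep_bideg n).mono fun _ => inf_le_left
  rw [← finrank_biSup_eq_sum hA, ← finrank_biSup_eq_sum (iSupIndep_bideg n)]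
  set W : Submodule ℂ (MvPolynomial (Var n) ℂ) := ⨆ x ∈ s, bidegInv n (G : Set _) x with hW
  set V : Submodule ℂ (MvPolynomial (Var n) ℂ) := ⨆ x ∈ t, bideg n x with hV
  have hWinv : W ≤ invariantPoly n (G : Set _) := iSup₂_le fun x _ => inf_le_right
  have : FiniteDimensional ℂ V := finiteDimensional_biSup _ t
  have : FiniteDimensional ℂ W := finiteDimensional_biSup _ s
  let e : Fin (Nat.card G) ≃ G := (Finite.equivFin G).symm
  have hmul : ∀ i < Nat.card G, ∀ w ∈ W, l ^ i * w ∈ V := by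
    intro i hi w hw
    have : W ≤ V.comap (LinearMap.mulLeft ℂ (l ^ i)) := iSup₂_le fun x hx f hf => by
      refine Submodule.mem_iSup_of_mem (x + i • δ) (Submodule.mem_iSup_of_mem (hst x hx i hi) ?_)
      rw [add_comm]
      exact mul_mem_bideg (pow_mem_bideg hl i) hf.1
    exact this hw
  let Φ : (Fin (Nat.card G) → W) →ₗ[ℂ] V := LinearMap.codRestrict V
    (∑ i : Fin (Nat.card G), (LinearMap.mulLeft ℂ (l ^ (i : ℕ))) ∘ₗ W.subtype ∘ₗ LinearMap.proj i)
    (fun w => by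
      rw [LinearMap.sum_apply]
      exact Submodule.sum_mem _ fun i _ => hmul i i.2 _ (w i).2)
  have hΦ : Function.Injective Φ := by
    rw [← LinearMap.ker_eq_bot, LinearMap.ker_eq_bot']
    intro w hw
    have h0 : ∑ i : Fin (Nat.card G), l ^ (i : ℕ) * (w i : MvPolynomial (Var n) ℂ) = 0 := by
      simpa [Φ, LinearMap.sum_apply] using congrArg Subtype.val hw
    have h1 := Matrix.eq_zero_of_forall_index_sum_pow_mul_eq_zero (R := MvPolynomial (Var n) ℂ)
      (f := fun i => uAct n (e i) l) (v := fun i => w i) (hinj.comp e.injective) (fun j => by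
        rw [← map_zero (uAct n (e j)), ← h0, map_sum]
        refine Finset.sum_congr rfl fun i _ => ?_
        rw [map_mul, map_pow, mem_invariantPoly.mp (hWinv (w i).2) _ (e j).2])
    exact funext fun i => Subtype.ext (congrFun h1 i)
  simpa [Module.finrank_pi_fintype] using LinearMap.finrank_le_finrank_of_injective hΦ

lemma sum_finrank_le_card_mul {n : ℕ} (G : Subgroup (Matrix.unitaryGroup (Fin n) ℂ)) [Finite G]
    {l : MvPolynomial (Var n) ℂ} {δ : ℕ × ℕ} (hl : l ∈ bideg n δ)
    (hinj : Function.Injective fun g : G => uAct n g l) {s t : Finset (ℕ × ℕ)}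
    (hst : ∀ x ∈ s, ∀ i < Nat.card G, x + i • δ ∈ t) :
    ∑ x ∈ s, Module.finrank ℂ (bideg n x) ≤
      Nat.card G * ∑ x ∈ t, Module.finrank ℂ (bidegInv n (G : Set _) x) := by
  have := Fintype.ofFinite G
  have hA : iSupIndep (bidegInv n (G : Set _)) := (iSupIndep_bideg n).mono fun _ => inf_le_left
  rw [← finrank_biSup_eq_sum hA, ← finrank_biSup_eq_sum (iSupIndep_bideg n)]
  set W : Submodule ℂ (MvPolynomial (Var n) ℂ) := ⨆ x ∈ t, bidegInv n (G : Set _) x with hW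
  set V : Submodule ℂ (MvPolynomial (Var n) ℂ) := ⨆ x ∈ s, bideg n x with hV
  have : FiniteDimensional ℂ W := finiteDimensional_biSup _ t
  let e : Fin (Nat.card G) ≃ G := (Finite.equivFin G).symm
  let A : ℕ → MvPolynomial (Var n) ℂ →ₗ[ℂ] MvPolynomial (Var n) ℂ := fun i =>
    ∑ g : G, (uAct n g).toLinearMap ∘ₗ LinearMap.mulLeft ℂ (l ^ i)
  have hA_apply : ∀ i f, A i f = ∑ g : G, uAct n g (l ^ i * f) := fun i f => by
    simp [A, LinearMap.sum_apply]
  have hmem : ∀ i < Nat.card G, ∀ f ∈ V, A i f ∈ W := by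
    intro i hi f hf
    have : V ≤ W.comap (A i) := iSup₂_le fun x hx f hf => by
      refine Submodule.mem_iSup_of_mem (x + i • δ) (Submodule.mem_iSup_of_mem (hst x hx i hi) ?_)
      rw [hA_apply, add_comm]
      exact sum_uAct_mem_bidegInv G (mul_mem_bideg (pow_mem_bideg hl i) hf)
    exact this hf
  let Φ : V →ₗ[ℂ] (Fin (Nat.card G) → W) := LinearMap.pi fun i =>
    (A i).restrict (hmem i i.2)
  have hΦ : Function.Injective Φ := by
    rw [← LinearMap.ker_eq_bot, LinearMap.ker_eq_bot']
    intro f hf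
    have h0 : ∀ i : Fin (Nat.card G), A i f = 0 := fun i => congrArg Subtype.val (congrFun hf i)
    have h1 := Matrix.eq_zero_of_forall_pow_sum_mul_pow_eq_zero (R := MvPolynomial (Var n) ℂ)
      (f := fun i => uAct n (e i) l) (v := fun i => uAct n (e i) f) (hinj.comp e.injective)
      (fun i => by
        rw [← h0 i, hA_apply]
        refine Fintype.sum_equiv e _ _ fun j => ?_
        rw [map_mul, map_pow, mul_comm])
    have h2 := congrFun h1 (e.symm 1)
    simp only [Equiv.apply_symm_apply, OneMemClass.coe_one, uAct_one, AlgHom.id_apply,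
      Pi.zero_apply] at h2
    exact Subtype.ext h2
  simpa [Module.finrank_pi_fintype] using LinearMap.finrank_le_finrank_of_injective hΦ

lemma sum_divisorRegion_eq (m : ℕ) (h : ℕ → ℕ → ℝ) (L : ℕ) :
    ∑ x ∈ (Finset.range (L + 1) ×ˢ Finset.range (L + 1)).filter
        (fun x => 0 < x.2 * (x.1 + m + 1) ∧ x.2 * (x.1 + m + 1) ≤ L), h x.1 x.2 =
      ∑ j ∈ Finset.range (L + 1), (∑ p ∈ Finset.Ico (j + 1) (L / (j + 1) - m), h p (j + 1) +
        ∑ q ∈ Finset.Ico (j + 1) (L / (j + m + 1) + 1), h j q) := by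
  rw [← Finset.sum_filter_add_sum_filter_not _ (fun x : ℕ × ℕ => x.2 ≤ x.1),
    Finset.sum_add_distrib, Finset.sum_sigma', Finset.sum_sigma']
  have key : ∀ a b : ℕ, 0 < b → (0 < b * (a + m + 1)) := fun a b hb => by positivity
  congr 1
  · refine Finset.sum_nbij' (fun x => ⟨x.2 - 1, x.1⟩) (fun x => (x.2, x.1 + 1)) ?_ ?_ ?_ ?_ ?_
    · rintro ⟨p, q⟩ hx
      simp only [Finset.mem_filter, Finset.mem_product, Finset.mem_range, Finset.mem_sigma,
        Finset.mem_Ico] at hx ⊢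
      obtain ⟨⟨⟨hp, hq⟩, h0, hL⟩, hqp⟩ := hx
      obtain ⟨q, rfl⟩ := Nat.exists_eq_succ_of_ne_zero (Nat.pos_of_mul_pos_right h0).ne'
      have := (Nat.le_div_iff_mul_le (Nat.succ_pos q)).mpr ((mul_comm _ _).trans_le hL)
      simp only [Nat.succ_eq_add_one, Nat.add_sub_cancel] at *
      omega
    · rintro ⟨j, p⟩ hx
      simp only [Finset.mem_filter, Finset.mem_product, Finset.mem_range, Finset.mem_sigma,
        Finset.mem_Ico] at hx ⊢
      obtain ⟨hj, hjp, hp⟩ := hx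
      have hle : p + m + 1 ≤ L / (j + 1) := by omega
      have hL := (Nat.le_div_iff_mul_le (Nat.succ_pos j)).mp hle
      have h1 : j + 1 ≤ L := by nlinarith
      have h2 : p ≤ L := by nlinarith
      refine ⟨⟨⟨by omega, by omega⟩, by positivity, by linarith⟩, hjp⟩
    · rintro ⟨p, q⟩ hx
      simp only [Finset.mem_filter, Finset.mem_product, Finset.mem_range] at hx
      have := Nat.pos_of_mul_pos_right hx.1.2.1
      simp only [Prod.mk.injEq, true_and]
      omega
    · rintro ⟨j, p⟩ _
      rfl
    · rintro ⟨p, q⟩ hx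
      simp only [Finset.mem_filter, Finset.mem_product, Finset.mem_range] at hx
      have := Nat.pos_of_mul_pos_right hx.1.2.1
      simp only [Nat.sub_add_cancel this]
  · refine Finset.sum_nbij' (fun x => ⟨x.1, x.2⟩) (fun x => (x.1, x.2)) ?_ ?_ ?_ ?_ ?_
    · rintro ⟨p, q⟩ hx
      simp only [Finset.mem_filter, Finset.mem_product, Finset.mem_range, Finset.mem_sigma,
        Finset.mem_Ico] at hx ⊢
      obtain ⟨⟨⟨hp, hq⟩, h0, hL⟩, hqp⟩ := hx
      have := (Nat.le_div_iff_mul_le (Nat.succ_pos (p + m))).mpr hL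
      simp only [Nat.succ_eq_add_one] at *
      omega
    · rintro ⟨j, q⟩ hx
      simp only [Finset.mem_filter, Finset.mem_product, Finset.mem_range, Finset.mem_sigma,
        Finset.mem_Ico] at hx ⊢
      obtain ⟨hj, hjq, hq⟩ := hx
      have hle : q ≤ L / (j + m + 1) := by omega
      have hL := (Nat.le_div_iff_mul_le (Nat.succ_pos (j + m))).mp hle
      simp only [Nat.succ_eq_add_one] at *
      have h2 : q ≤ L := by nlinarith
      refine ⟨⟨⟨by omega, by omega⟩, key _ _ (by omega), hL⟩, by omega⟩
    · rintro ⟨p, q⟩ _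
      rfl
    · rintro ⟨j, p⟩ _
      rfl
    · rintro ⟨p, q⟩ _
      rfl

lemma tendsto_div_of_abs_sub_le {M : ℕ → ℕ} {c C : ℝ} (hM : ∀ L : ℕ, |(M L : ℝ) - c * L| ≤ C) :
    Tendsto (fun L : ℕ => (M L : ℝ) / L) atTop (nhds c) := by
  have h0 : Tendsto (fun L : ℕ => ((M L : ℝ) - c * L) / L) atTop (nhds 0) := by
    refine squeeze_zero_norm (a := fun L : ℕ => C / L) (fun L => ?_)
      (tendsto_const_div_atTop_nhds_zero_nat C)
    rw [norm_div, Real.norm_eq_abs, Real.norm_natCast]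
    exact div_le_div_of_nonneg_right (hM L) L.cast_nonneg
  have h1 := h0.add_const c
  rw [zero_add] at h1
  refine h1.congr' ?_
  filter_upwards [eventually_ne_atTop 0] with L hL
  field_simp
  ring

lemma tendsto_sum_Ico_div_pow {n : ℕ} {f : ℕ → ℝ} {β : ℝ}
    (hf : Tendsto (fun N : ℕ => (∑ i ∈ Finset.range N, f i) / (N : ℝ) ^ n) atTop (nhds β))
    (hn : n ≠ 0) {M : ℕ → ℕ} {c C : ℝ} (hc : 0 < c) (hM : ∀ L : ℕ, |(M L : ℝ) - c * L| ≤ C)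
    (k : ℕ) :
    Tendsto (fun L : ℕ => (∑ i ∈ Finset.Ico k (M L), f i) / (L : ℝ) ^ n) atTop
      (nhds (β * c ^ n)) := by
  have hMtop : Tendsto M atTop atTop := by
    rw [← tendsto_natCast_atTop_iff (R := ℝ)]
    refine tendsto_atTop_mono (f := fun L : ℕ => c * L + -C) (fun L => ?_)
      (tendsto_atTop_add_const_right _ _ (tendsto_natCast_atTop_atTop.const_mul_atTop hc))
    linarith [(abs_le.mp (hM L)).1]
  have h1 := (hf.comp hMtop).mul ((tendsto_div_of_abs_sub_le hM).pow n)
  have h2 : Tendsto (fun L : ℕ => (∑ i ∈ Finset.range k, f i) / (L : ℝ) ^ n) atTop (nhds 0) :=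
    tendsto_const_nhds.div_atTop ((tendsto_pow_atTop hn).comp tendsto_natCast_atTop_atTop)
  have h3 := h1.sub h2
  rw [sub_zero] at h3
  refine h3.congr' ?_
  filter_upwards [hMtop.eventually_ge_atTop (k + 1), eventually_ne_atTop 0] with L hL hL0
  have hM0 : (M L : ℝ) ≠ 0 := Nat.cast_ne_zero.mpr (by omega)
  have hL0' : (L : ℝ) ≠ 0 := Nat.cast_ne_zero.mpr hL0
  rw [Finset.sum_Ico_eq_sub _ (by omega : k ≤ M L), Function.comp_apply, div_pow]
  field_simp

lemma abs_natDiv_sub_le (L d : ℕ) (hd : 0 < d) : |((L / d : ℕ) : ℝ) - (d : ℝ)⁻¹ * L| ≤ 1 := by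
  have h1 : ((L / d : ℕ) : ℝ) ≤ L / d := Nat.cast_div_le
  have h2 : (L : ℝ) / d < (L / d : ℕ) + 1 := by
    rw [div_lt_iff₀ (by exact_mod_cast hd)]
    exact_mod_cast Nat.lt_mul_of_div_lt (Nat.lt_succ_self (L / d)) hd
  rw [← div_eq_inv_mul, abs_le]
  constructor <;> linarith

lemma sum_div_pow_le {f : ℕ → ℝ} {j m L : ℕ} {s : Finset ℕ} (hs : s.card ≤ L / (j + 1))
    (hf : ∀ i ∈ s, f i ≤ (2 * (L / (j + 1) : ℕ) : ℝ) ^ m * (2 * (j + 1)) ^ m *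
      (4 * (L / (j + 1) : ℕ))) :
    (∑ i ∈ s, f i) / (L : ℝ) ^ (m + 2) ≤ 4 ^ (m + 1) * (1 / ((j : ℝ) + 1) ^ 2) := by
  set K : ℝ := ((L / (j + 1) : ℕ) : ℝ) with hK
  have hK0 : 0 ≤ K := Nat.cast_nonneg _
  have hKL : K ≤ L / ((j : ℝ) + 1) := by
    have := Nat.cast_div_le (α := ℝ) (m := L) (n := j + 1)
    push_cast at this
    exact this
  have hj : (0 : ℝ) < (j : ℝ) + 1 := by positivity
  have hsum : ∑ i ∈ s, f i ≤ 4 ^ (m + 1) * (1 / ((j : ℝ) + 1) ^ 2) * (L : ℝ) ^ (m + 2) := by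
    calc ∑ i ∈ s, f i ≤ s.card • ((2 * K) ^ m * (2 * (j + 1)) ^ m * (4 * K)) :=
          Finset.sum_le_card_nsmul _ _ _ hf
      _ ≤ K * ((2 * K) ^ m * (2 * (j + 1)) ^ m * (4 * K)) := by
          rw [nsmul_eq_mul]
          exact mul_le_mul_of_nonneg_right (Nat.cast_le.mpr hs) (by positivity)
      _ = 4 ^ (m + 1) * ((j : ℝ) + 1) ^ m * K ^ (m + 2) := by
          rw [mul_pow, mul_pow, show (4 : ℝ) ^ (m + 1) = 2 ^ m * 2 ^ m * 4 by
            rw [← mul_pow]; norm_num [pow_succ]]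
          ring
      _ ≤ 4 ^ (m + 1) * ((j : ℝ) + 1) ^ m * (L / ((j : ℝ) + 1)) ^ (m + 2) := by gcongr
      _ = _ := by
          rw [div_pow]
          field_simp
          ring
  exact div_le_of_le_mul₀ (by positivity) (by positivity) hsum

/-- Asymptotics of the sum over `0 < q (p + m + 1) ≤ L` of a function of controlled growth,
whose partial sums along rows and columns are asymptotically monomial. -/
lemma tendsto_sum_divisorRegion (m : ℕ) (h : ℕ → ℕ → ℝ) (β : ℕ → ℝ) (h0 : ∀ p q, 0 ≤ h p q)
    (hb : ∀ p q : ℕ, h p q ≤ ((p : ℝ) + 1) ^ m * ((q : ℝ) + 1) ^ m * ((p : ℝ) + 1 + (q + 1)))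
    (hrow : ∀ q, Tendsto (fun N : ℕ => (∑ p ∈ Finset.range N, h p q) / (N : ℝ) ^ (m + 2)) atTop
      (nhds (β q)))
    (hcol : ∀ p, Tendsto (fun N : ℕ => (∑ q ∈ Finset.range N, h p q) / (N : ℝ) ^ (m + 2)) atTop
      (nhds (β p))) :
    Summable (fun j : ℕ => β (j + 1) * (((j + 1 : ℕ) : ℝ)⁻¹) ^ (m + 2) +
      β j * (((j + m + 1 : ℕ) : ℝ)⁻¹) ^ (m + 2)) ∧
    Tendsto (fun L : ℕ => (∑ x ∈ (Finset.range (L + 1) ×ˢ Finset.range (L + 1)).filter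
        (fun x => 0 < x.2 * (x.1 + m + 1) ∧ x.2 * (x.1 + m + 1) ≤ L), h x.1 x.2) /
        (L : ℝ) ^ (m + 2)) atTop
      (nhds (∑' j : ℕ, (β (j + 1) * (((j + 1 : ℕ) : ℝ)⁻¹) ^ (m + 2) +
        β j * (((j + m + 1 : ℕ) : ℝ)⁻¹) ^ (m + 2)))) := by
  let F : ℕ → ℕ → ℝ := fun L j =>
    (∑ p ∈ Finset.Ico (j + 1) (L / (j + 1) - m), h p (j + 1)) / (L : ℝ) ^ (m + 2) +
      (∑ q ∈ Finset.Ico (j + 1) (L / (j + m + 1) + 1), h j q) / (L : ℝ) ^ (m + 2)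
  let bound : ℕ → ℝ := fun j => 2 * 4 ^ (m + 1) * (1 / ((j : ℝ) + 1) ^ 2)
  have hbound : Summable bound := by
    have := (summable_nat_add_iff 1).mpr (Real.summable_one_div_nat_pow.mpr one_lt_two)
    push_cast at this
    exact this.mul_left _
  have hF0 : ∀ L j, 0 ≤ F L j := fun L j => add_nonneg
    (div_nonneg (Finset.sum_nonneg fun _ _ => h0 _ _) (by positivity))
    (div_nonneg (Finset.sum_nonneg fun _ _ => h0 _ _) (by positivity))
  have hFb : ∀ L j, F L j ≤ bound j := by
    intro L j
    have e : bound j = 4 ^ (m + 1) * (1 / ((j : ℝ) + 1) ^ 2) +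
      4 ^ (m + 1) * (1 / ((j : ℝ) + 1) ^ 2) := by simp only [bound]; ring
    rw [e]
    have hK : L / (j + m + 1) ≤ L / (j + 1) := Nat.div_le_div_left (by omega) (by omega)
    refine add_le_add (sum_div_pow_le
      ((Nat.card_Ico _ _).trans_le ((Nat.sub_le _ _).trans (Nat.sub_le _ _))) fun p hp => ?_)
      (sum_div_pow_le
      ((Nat.card_Ico _ _).trans_le (by rw [Nat.add_sub_add_right]; exact (Nat.sub_le _ _).trans hK))
      fun q hq => ?_)
    · rw [Finset.mem_Ico] at hp
      have h1 : (p : ℝ) + 1 ≤ (L / (j + 1) : ℕ) := by exact_mod_cast (by omega)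
      have h2 : (j : ℝ) + 1 ≤ p := by exact_mod_cast hp.1
      refine (hb _ _).trans ?_
      push_cast
      gcongr
      · linarith
      · linarith
      · linarith
    · rw [Finset.mem_Ico] at hq
      have h1 : (q : ℝ) ≤ (L / (j + 1) : ℕ) := by exact_mod_cast (by omega)
      have h2 : (j : ℝ) + 1 ≤ q := by exact_mod_cast hq.1
      have h3 : (0 : ℝ) ≤ j := j.cast_nonneg
      refine (hb _ _).trans ?_
      rw [mul_comm (((j : ℝ) + 1) ^ m)]
      gcongr
      · linarith
      · linarith
      · linarith
  have hlim : ∀ j, Tendsto (F · j) atTop (nhds (β (j + 1) * (((j + 1 : ℕ) : ℝ)⁻¹) ^ (m + 2) +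
      β j * (((j + m + 1 : ℕ) : ℝ)⁻¹) ^ (m + 2))) := by
    intro j
    refine (tendsto_sum_Ico_div_pow (C := 1 + m) (hrow (j + 1)) (by omega) (by positivity)
      (fun L => ?_) (j + 1)).add (tendsto_sum_Ico_div_pow (C := 2) (hcol j) (by omega)
      (by positivity) (fun L => ?_) (j + 1))
    · have h1 := abs_natDiv_sub_le L (j + 1) (by omega)
      have h2 : |((L / (j + 1) - m : ℕ) : ℝ) - (L / (j + 1) : ℕ)| ≤ m := by
        rw [abs_le]
        constructor
        · have : L / (j + 1) ≤ L / (j + 1) - m + m := by omega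
          have : ((L / (j + 1) : ℕ) : ℝ) ≤ (L / (j + 1) - m : ℕ) + m := by exact_mod_cast this
          linarith
        · have : ((L / (j + 1) - m : ℕ) : ℝ) ≤ (L / (j + 1) : ℕ) :=
            Nat.cast_le.mpr (Nat.sub_le _ _)
          have := m.cast_nonneg (α := ℝ)
          linarith
      have := abs_sub_le ((L / (j + 1) - m : ℕ) : ℝ) (L / (j + 1) : ℕ) (((j + 1 : ℕ) : ℝ)⁻¹ * L)
      linarith
    · have h1 := abs_le.mp (abs_natDiv_sub_le L (j + m + 1) (by omega))
      rw [abs_le, Nat.cast_succ]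
      constructor <;> linarith
  refine ⟨hbound.of_norm_bounded fun j => ?_, ?_⟩
  · exact le_of_tendsto (hlim j).norm (Eventually.of_forall fun L => by
      rw [Real.norm_of_nonneg (hF0 L j)]
      exact hFb L j)
  · refine (tendsto_tsum_of_dominated_convergence hbound hlim (Eventually.of_forall fun L j => by
      rw [Real.norm_of_nonneg (hF0 L j)]
      exact hFb L j)).congr fun L => ?_
    rw [sum_divisorRegion_eq, Finset.sum_div, tsum_eq_sum (s := Finset.range (L + 1))]
    · exact Finset.sum_congr rfl fun j _ => (add_div _ _ _).symm
    · intro j hj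
      rw [Finset.mem_range, not_lt] at hj
      simp only [F]
      rw [Nat.div_eq_of_lt (by omega), Nat.div_eq_of_lt (by omega), Finset.Ico_eq_empty (by omega),
        Finset.Ico_eq_empty (by omega)]
      simp

lemma tendsto_shift_div_pow {f : ℕ → ℝ} {c : ℝ} {n : ℕ}
    (hf : Tendsto (fun N : ℕ => f N / (N : ℝ) ^ n) atTop (nhds c)) (a b : ℕ) :
    Tendsto (fun N : ℕ => f (N + a) / ((N + b : ℕ) : ℝ) ^ n) atTop (nhds c) := by
  have h1 := (tendsto_add_mul_div_add_mul_atTop_nhds (a : ℝ) b 1 one_ne_zero).pow n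
  have h2 := ((tendsto_add_atTop_iff_nat a).mpr hf).mul h1
  rw [div_one, one_pow, mul_one] at h2
  refine h2.congr' ?_
  filter_upwards [eventually_ne_atTop 0] with N hN
  have ha : (a : ℝ) + 1 * N ≠ 0 := by positivity
  have hb : (b : ℝ) + 1 * N ≠ 0 := by positivity
  have e : ∀ d : ℕ, ((N + d : ℕ) : ℝ) = (d : ℝ) + 1 * N := fun d => by push_cast; ring
  rw [e, e, div_pow]
  field_simp

lemma tendsto_sum_multichoose_div_pow (n : ℕ) :
    Tendsto (fun N : ℕ => (∑ p ∈ Finset.range N, ((n + 1).multichoose p : ℝ)) / (N : ℝ) ^ (n + 1))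
      atTop (nhds (1 / (n + 1).factorial)) := by
  have h1 : Tendsto (fun N : ℕ => (N.choose (n + 1) : ℝ) / (N : ℝ) ^ (n + 1)) atTop
      (nhds (1 / (n + 1).factorial)) := by
    have h := ((isEquivalent_choose (n + 1)).div
      (Asymptotics.IsEquivalent.refl (u := fun N : ℕ => (N : ℝ) ^ (n + 1)))).symm
    refine h.tendsto_nhds (tendsto_const_nhds.congr' ?_)
    filter_upwards [eventually_ne_atTop 0] with N hN
    simp only [Pi.div_apply]
    field_simp
  refine (tendsto_shift_div_pow h1 n 0).congr' ?_
  filter_upwards [eventually_ne_atTop 0] with N hN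
  obtain ⟨M, rfl⟩ := Nat.exists_eq_succ_of_ne_zero hN
  rw [← Nat.cast_sum, Nat.succ_eq_add_one, Nat.sum_range_multichoose, add_zero]
  congr 3
  ring

lemma tendsto_div_pow_of_shifted_bounds {S U : ℕ → ℝ} {a c : ℝ} {n g : ℕ} (hg : 0 < g)
    (hS : Tendsto (fun N : ℕ => S N / (N : ℝ) ^ n) atTop (nhds c))
    (hU : ∀ N, g * U N ≤ a * S (N + g)) (hU' : ∀ N, a * S N ≤ g * U (N + g)) :
    Tendsto (fun N : ℕ => U N / (N : ℝ) ^ n) atTop (nhds (a * (c / g))) := by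
  have hg' : (0 : ℝ) < g := Nat.cast_pos.mpr hg
  rw [← tendsto_add_atTop_iff_nat g]
  have e : a * (c / g) = a / g * c := by ring
  rw [e]
  refine tendsto_of_tendsto_of_tendsto_of_le_of_le
    ((tendsto_shift_div_pow hS 0 g).const_mul (a / g))
    ((tendsto_shift_div_pow hS (g + g) g).const_mul (a / g)) (fun N => ?_) (fun N => ?_)
  · simp only
    rw [← mul_div_assoc]
    refine div_le_div_of_nonneg_right ?_ (by positivity)
    rw [div_mul_eq_mul_div, div_le_iff₀ hg', mul_comm _ (g : ℝ)]
    exact hU' N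
  · simp only
    rw [← mul_div_assoc]
    refine div_le_div_of_nonneg_right ?_ (by positivity)
    rw [div_mul_eq_mul_div, le_div_iff₀ hg', mul_comm _ (g : ℝ), ← add_assoc]
    exact hU (N + g)

lemma tendsto_sum_of_diagonal_recursion {u h : ℕ → ℕ → ℕ} {m n : ℕ} {c : ℝ}
    (hadd : ∀ p q, u p q + h (p + 1) (q + 1) = u (p + 1) (q + 1))
    (hleft : ∀ q, h 0 q = u 0 q) (hright : ∀ p, h p 0 = u p 0)
    (hu : ∀ q, Tendsto (fun N : ℕ => (∑ p ∈ Finset.range N, (u p q : ℝ)) / (N : ℝ) ^ n) atTop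
      (nhds ((m + 1).multichoose q * c))) (q : ℕ) :
    Tendsto (fun N : ℕ => (∑ p ∈ Finset.range N, (h p q : ℝ)) / (N : ℝ) ^ n) atTop
      (nhds (m.multichoose q * c)) := by
  cases q with
  | zero => simpa only [hright, Nat.multichoose_zero_right] using hu 0
  | succ k =>
    have e : (m.multichoose (k + 1) * c : ℝ) =
        (m + 1).multichoose (k + 1) * c - (m + 1).multichoose k * c := by
      rw [Nat.multichoose_succ_succ, Nat.cast_add]
      ring
    rw [e, ← tendsto_add_atTop_iff_nat 1]
    refine (((tendsto_add_atTop_iff_nat 1).mpr (hu (k + 1))).sub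
      (tendsto_shift_div_pow (hu k) 0 1)).congr fun N => ?_
    rw [← sub_div, add_zero, Finset.sum_range_succ', Finset.sum_range_succ', hleft]
    simp only [← hadd, Nat.cast_add, Finset.sum_add_distrib]
    ring

lemma multichoose_succ_le_pow (k p : ℕ) : (k + 1).multichoose p ≤ (p + 1) ^ k := by
  induction k generalizing p with
  | zero => simp
  | succ k ih =>
    induction p with
    | zero => simp
    | succ p ihp =>
      rw [Nat.multichoose_succ_succ]
      calc _ ≤ (p + 1 + 1) ^ k + (p + 1) ^ k * (p + 1) := add_le_add (ih _) ihp
        _ ≤ (p + 1 + 1) ^ k + (p + 1 + 1) ^ k * (p + 1) := by gcongr; omega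
        _ = _ := by ring

lemma finrank_Hpq_le (m p q : ℕ) :
    Module.finrank ℂ (Hpq (m + 2) p q) ≤ (p + 1) ^ m * (q + 1) ^ m * (p + 1 + (q + 1)) := by
  rw [← dimHpqInv_bot]
  have h0 : p = 0 ∨ q = 0 → Module.finrank ℂ (bideg (m + 2) (p, q)) ≤
      (p + 1) ^ m * (q + 1) ^ m * (p + 1 + (q + 1)) := by
    intro h
    rw [finrank_bideg]
    refine (Nat.mul_le_mul (multichoose_succ_le_pow (m + 1) p)
      (multichoose_succ_le_pow (m + 1) q)).trans ?_
    calc (p + 1) ^ (m + 1) * (q + 1) ^ (m + 1)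
        = (p + 1) ^ m * (q + 1) ^ m * ((p + 1) * (q + 1)) := by ring
      _ ≤ _ := by
        refine Nat.mul_le_mul_left _ ?_
        rcases h with rfl | rfl <;> omega
  rcases p with _ | p
  · rw [dimHpqInv_of_eq_zero (Or.inl rfl), bidegInv_bot]
    exact h0 (Or.inl rfl)
  rcases q with _ | q
  · rw [dimHpqInv_of_eq_zero (Or.inr rfl), bidegInv_bot]
    exact h0 (Or.inr rfl)
  have h := dimHpqInv_add (Nat.succ_pos (m + 1)) ⊥ p q
  rw [bidegInv_bot, bidegInv_bot, finrank_bideg, finrank_bideg] at h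
  rw [Nat.succ_eq_add_one, Nat.multichoose_succ_succ (m + 1) p,
    Nat.multichoose_succ_succ (m + 1) q] at h
  have hp := multichoose_succ_le_pow m (p + 1)
  have hq := multichoose_succ_le_pow m (q + 1)
  have hp' : (m + 1 + 1).multichoose p ≤ (p + 1 + 1) ^ (m + 1) :=
    (multichoose_succ_le_pow (m + 1) p).trans (Nat.pow_le_pow_left (by omega) _)
  have hq' := multichoose_succ_le_pow (m + 1) (q + 1)
  rw [Nat.multichoose_succ_succ] at hq'
  have h1 := Nat.mul_le_mul hp hq'
  have h2 := Nat.mul_le_mul hp' hq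
  have e : (p + 1 + 1) ^ m * (q + 1 + 1) ^ m * (p + 1 + 1 + (q + 1 + 1)) =
      (p + 1 + 1) ^ m * (q + 1 + 1) ^ (m + 1) + (p + 1 + 1) ^ (m + 1) * (q + 1 + 1) ^ m := by
    ring
  rw [e]
  nlinarith

lemma tendsto_sum_finrank_bidegInv_left (m : ℕ)
    (G : Subgroup (Matrix.unitaryGroup (Fin (m + 2)) ℂ)) [Finite G] (q : ℕ) :
    Tendsto (fun N : ℕ => (∑ p ∈ Finset.range N,
        (Module.finrank ℂ (bidegInv (m + 2) (G : Set _) (p, q)) : ℝ)) / (N : ℝ) ^ (m + 2)) atTop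
      (nhds ((m + 2).multichoose q * (1 / (m + 2).factorial / Nat.card G))) := by
  obtain ⟨l, hl, hinj⟩ := exists_injective_uAct G eq_one_of_uAct_bideg_one_zero
  have hst : ∀ N, ∀ x ∈ Finset.range N ×ˢ {q}, ∀ i < Nat.card G,
      x + i • ((1, 0) : ℕ × ℕ) ∈ Finset.range (N + Nat.card G) ×ˢ {q} := by
    rintro N ⟨p, q'⟩ hx i hi
    simp only [Finset.mem_product, Finset.mem_range, Finset.mem_singleton] at hx
    simp [hx.2, add_lt_add hx.1 hi]
  refine tendsto_div_pow_of_shifted_bounds Nat.card_pos (tendsto_sum_multichoose_div_pow (m + 1))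
    (fun N => ?_) fun N => ?_
  · have h := card_mul_sum_finrank_le G hl hinj (hst N)
    simp only [Finset.sum_product, Finset.sum_singleton, finrank_bideg, ← Finset.sum_mul] at h
    rw [mul_comm (((m + 2).multichoose q : ℕ) : ℝ)]
    exact_mod_cast h
  · have h := sum_finrank_le_card_mul G hl hinj (hst N)
    simp only [Finset.sum_product, Finset.sum_singleton, finrank_bideg, ← Finset.sum_mul] at h
    rw [mul_comm (((m + 2).multichoose q : ℕ) : ℝ)]
    exact_mod_cast h

lemma tendsto_sum_finrank_bidegInv_right (m : ℕ)
    (G : Subgroup (Matrix.unitaryGroup (Fin (m + 2)) ℂ)) [Finite G] (p : ℕ) :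
    Tendsto (fun N : ℕ => (∑ q ∈ Finset.range N,
        (Module.finrank ℂ (bidegInv (m + 2) (G : Set _) (p, q)) : ℝ)) / (N : ℝ) ^ (m + 2)) atTop
      (nhds ((m + 2).multichoose p * (1 / (m + 2).factorial / Nat.card G))) := by
  obtain ⟨l, hl, hinj⟩ := exists_injective_uAct G eq_one_of_uAct_bideg_zero_one
  have hst : ∀ N, ∀ x ∈ {p} ×ˢ Finset.range N, ∀ i < Nat.card G,
      x + i • ((0, 1) : ℕ × ℕ) ∈ {p} ×ˢ Finset.range (N + Nat.card G) := by
    rintro N ⟨p', q⟩ hx i hi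
    simp only [Finset.mem_product, Finset.mem_range, Finset.mem_singleton] at hx
    simp [hx.1, add_lt_add hx.2 hi]
  refine tendsto_div_pow_of_shifted_bounds Nat.card_pos (tendsto_sum_multichoose_div_pow (m + 1))
    (fun N => ?_) fun N => ?_
  · have h := card_mul_sum_finrank_le G hl hinj (hst N)
    simp only [Finset.sum_product, Finset.sum_singleton, finrank_bideg, ← Finset.mul_sum] at h
    exact_mod_cast h
  · have h := sum_finrank_le_card_mul G hl hinj (hst N)
    simp only [Finset.sum_product, Finset.sum_singleton, finrank_bideg, ← Finset.mul_sum] at h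
    exact_mod_cast h

lemma dimHGlam_eq (m : ℕ) (S : Set (Matrix.unitaryGroup (Fin (m + 2)) ℂ)) {lam : ℝ}
    (hlam : 0 ≤ lam) :
    (dimHGlam (m + 2) S lam : ℝ) =
      ∑ x ∈ (Finset.range (⌊lam⌋₊ + 1) ×ˢ Finset.range (⌊lam⌋₊ + 1)).filter
        (fun x => 0 < x.2 * (x.1 + m + 1) ∧ x.2 * (x.1 + m + 1) ≤ ⌊lam⌋₊),
        (dimHpqInv (m + 2) x.1 x.2 S : ℝ) := by
  rw [dimHGlam, Nat.cast_sum]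
  refine Finset.sum_congr (Finset.filter_congr fun x _ => ?_) fun _ _ => rfl
  rw [show x.1 + (m + 2) - 1 = x.1 + m + 1 by omega, Nat.le_floor_iff hlam]

/-- The terms of the series giving the leading coefficient in `tendsto_dimHGlam_div_pow`. -/
def weylTerm (m j : ℕ) : ℝ :=
  (m + 1).multichoose (j + 1) * (1 / (m + 2).factorial) * (((j + 1 : ℕ) : ℝ)⁻¹) ^ (m + 2) +
    (m + 1).multichoose j * (1 / (m + 2).factorial) * (((j + m + 1 : ℕ) : ℝ)⁻¹) ^ (m + 2)

lemma weylTerm_div (m j : ℕ) (c : ℝ) :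
    (m + 1).multichoose (j + 1) * (1 / (m + 2).factorial / c) * (((j + 1 : ℕ) : ℝ)⁻¹) ^ (m + 2) +
      (m + 1).multichoose j * (1 / (m + 2).factorial / c) *
        (((j + m + 1 : ℕ) : ℝ)⁻¹) ^ (m + 2) = weylTerm m j / c := by
  rw [weylTerm]
  ring

lemma tendsto_sum_dimHpqInv_left (m : ℕ)
    (G : Subgroup (Matrix.unitaryGroup (Fin (m + 2)) ℂ)) [Finite G] (q : ℕ) :
    Tendsto (fun N : ℕ => (∑ p ∈ Finset.range N,
        (dimHpqInv (m + 2) p q (G : Set _) : ℝ)) / (N : ℝ) ^ (m + 2)) atTop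
      (nhds ((m + 1).multichoose q * (1 / (m + 2).factorial / Nat.card G))) :=
  tendsto_sum_of_diagonal_recursion (m := m + 1) (n := m + 2)
    (c := 1 / (m + 2).factorial / Nat.card G)
    (u := fun p q => Module.finrank ℂ (bidegInv (m + 2) (G : Set _) (p, q)))
    (h := fun p q => dimHpqInv (m + 2) p q (G : Set _))
    (fun p q => dimHpqInv_add (by omega) G p q)
    (fun _ => dimHpqInv_of_eq_zero (Or.inl rfl) _)
    (fun _ => dimHpqInv_of_eq_zero (Or.inr rfl) _)
    (tendsto_sum_finrank_bidegInv_left m G) q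

lemma tendsto_sum_dimHpqInv_right (m : ℕ)
    (G : Subgroup (Matrix.unitaryGroup (Fin (m + 2)) ℂ)) [Finite G] (p : ℕ) :
    Tendsto (fun N : ℕ => (∑ q ∈ Finset.range N,
        (dimHpqInv (m + 2) p q (G : Set _) : ℝ)) / (N : ℝ) ^ (m + 2)) atTop
      (nhds ((m + 1).multichoose p * (1 / (m + 2).factorial / Nat.card G))) :=
  tendsto_sum_of_diagonal_recursion (m := m + 1) (n := m + 2)
    (c := 1 / (m + 2).factorial / Nat.card G)
    (u := fun q p => Module.finrank ℂ (bidegInv (m + 2) (G : Set _) (p, q)))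
    (h := fun q p => dimHpqInv (m + 2) p q (G : Set _))
    (fun q p => dimHpqInv_add (by omega) G p q)
    (fun _ => dimHpqInv_of_eq_zero (Or.inr rfl) _)
    (fun _ => dimHpqInv_of_eq_zero (Or.inl rfl) _)
    (tendsto_sum_finrank_bidegInv_right m G) p

lemma summable_and_tendsto_dimHGlam (m : ℕ)
    (G : Subgroup (Matrix.unitaryGroup (Fin (m + 2)) ℂ)) [Finite G] :
    Summable (fun j => weylTerm m j / Nat.card G) ∧
      Tendsto (fun lam : ℝ => (dimHGlam (m + 2) (G : Set _) lam : ℝ) / (⌊lam⌋₊ : ℝ) ^ (m + 2))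
        atTop (nhds (∑' j, weylTerm m j / Nat.card G)) := by
  have h := tendsto_sum_divisorRegion m
    (fun p q => (dimHpqInv (m + 2) p q (G : Set _) : ℝ))
    (fun j => (m + 1).multichoose j * (1 / (m + 2).factorial / Nat.card G))
    (fun _ _ => Nat.cast_nonneg _)
    (fun p q => by exact_mod_cast (dimHpqInv_le _).trans (finrank_Hpq_le m p q))
    (tendsto_sum_dimHpqInv_left m G) (tendsto_sum_dimHpqInv_right m G)
  simp only [weylTerm_div] at h
  refine ⟨h.1, (h.2.comp (tendsto_nat_floor_atTop (α := ℝ))).congr' ?_⟩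
  filter_upwards [eventually_ge_atTop 0] with lam hlam
  rw [Function.comp_apply, dimHGlam_eq m _ hlam]

lemma tsum_weylTerm_pos (m : ℕ) : 0 < ∑' j, weylTerm m j := by
  have hs := (summable_and_tendsto_dimHGlam m ⊥).1
  simp only [Subgroup.card_bot, Nat.cast_one, div_one] at hs
  refine hs.tsum_pos (fun j => by rw [weylTerm]; positivity) 0 ?_
  have : 0 < (m + 1).multichoose 0 := by simp
  rw [weylTerm]
  positivity

/-- Weyl-type asymptotics of the invariant dimension count. -/
lemma tendsto_dimHGlam_div_pow (m : ℕ)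
    (G : Subgroup (Matrix.unitaryGroup (Fin (m + 2)) ℂ)) [Finite G] :
    Tendsto (fun lam : ℝ => (dimHGlam (m + 2) (G : Set _) lam : ℝ) / (⌊lam⌋₊ : ℝ) ^ (m + 2))
      atTop (nhds ((∑' j, weylTerm m j) / Nat.card G)) := by
  rw [← tsum_div_const]
  exact (summable_and_tendsto_dimHGlam m G).2

lemma dimHGlam_bot (n : ℕ) (lam : ℝ) :
    dimHGlam n ((⊥ : Subgroup (Matrix.unitaryGroup (Fin n) ℂ)) : Set _) lam = dimHlam n lam :=
  Finset.sum_congr rfl fun _ _ => dimHpqInv_bot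

/-- The invariant dimension count grows like `1/|G|` times the full count. -/
theorem dimH_div_dimHG_tendsto_card (n : ℕ) (hn : 2 ≤ n)
    (G : Subgroup (Matrix.unitaryGroup (Fin n) ℂ)) (hGfin : Finite G) :
    Filter.Tendsto (fun lam : ℝ => (dimHlam n lam : ℝ) / (dimHGlam n (G : Set _) lam))
      Filter.atTop (nhds (Nat.card G)) := by
  obtain ⟨m, rfl⟩ := Nat.exists_eq_add_of_le' hn
  have hG : (0 : ℝ) < Nat.card G := Nat.cast_pos.mpr Nat.card_pos
  have h1 := (tendsto_dimHGlam_div_pow m ⊥).div (tendsto_dimHGlam_div_pow m G)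
    (div_pos (tsum_weylTerm_pos m) hG).ne'
  have hΛ := (tsum_weylTerm_pos m).ne'
  have e : (∑' j, weylTerm m j) /
      (Nat.card (⊥ : Subgroup (Matrix.unitaryGroup (Fin (m + 2)) ℂ)) : ℝ) /
      ((∑' j, weylTerm m j) / Nat.card G) = Nat.card G := by
    rw [Subgroup.card_bot, Nat.cast_one]
    field_simp
  rw [e] at h1
  refine h1.congr' ?_
  filter_upwards [tendsto_nat_floor_atTop.eventually_ne_atTop 0] with lam hlam
  rw [Pi.div_apply, dimHGlam_bot, div_div_div_cancel_right₀]
  exact pow_ne_zero _ (Nat.cast_ne_zero.mpr hlam)
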